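/- Let P be a transition matrix on a finite set D, reversible with respect to a (positive) probability measure π, with second largest eigenvalue β₁ and second largest absolute eigenvalue β = max{β₁, |β_{|D|−1}|} < 1, and let ν be any initial distribution. Then for every f : D → ℝ, e_ν(S_{n,n₀},f)² ≤ 2‖f‖₂²/(n(1−β₁)) + 2βⁿ⁰ √(‖1/π‖_∞) ‖ν/π − 1‖₂ ‖f‖₂² / (n²(1−β)²). Moreover lim_{n→∞} n·e_ν(S_{n,n₀},f)² = lim_{n→∞} n·e_π(S_n,f)² = Σ_{k=1}^{|D|−1} a_k² (1+β_k)/(1−β_k), where a_k = ⟨f,u_k⟩. -/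

import Mathlib

open Finset

/-- Expectation, under the Markov chain with transition matrix `P` and initial
distribution `ν`, of a function `g` of the first `m+1` states `X₁,…,X_{m+1}`
(coordinates `0,…,m` of a path). -/
noncomputable def pathE {D : Type*} [Fintype D] (P : Matrix D D ℝ) (ν : D → ℝ) (m : ℕ)
    (g : (Fin (m + 1) → D) → ℝ) : ℝ :=
  ∑ x : Fin (m + 1) → D, (ν (x 0) * ∏ i : Fin m, P (x i.castSucc) (x i.succ)) * g x

/-- The mean square error `e_ν(S_{n,n₀},f)² = E_{ν,P}|S_{n,n₀}(f) − S(f)|²`, where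
`S_{n,n₀}(f) = (1/n) Σ_{j=1}^n f(X_{j+n₀})` and `S(f) = Σ_y f(y) π(y)`. -/
noncomputable def mse {D : Type*} [Fintype D] (P : Matrix D D ℝ) (π ν f : D → ℝ)
    (n n₀ : ℕ) : ℝ :=
  pathE P ν (n₀ + n) fun x =>
    ((∑ j : Fin n, f (x (Fin.castSucc (Fin.natAdd n₀ j)))) / (n : ℝ) - ∑ y, f y * π y) ^ 2

section PathExpectation

variable {D : Type*} [Fintype D]

lemma pathE_zero (P : Matrix D D ℝ) (ν : D → ℝ) (G : (Fin 1 → D) → ℝ) :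
    pathE P ν 0 G = ∑ x, ν x * G fun _ => x := by
  unfold pathE
  refine Fintype.sum_equiv (Equiv.funUnique (Fin 1) D) _ _ fun x => ?_
  have h : (fun _ => x 0) = x := by
    funext i
    rw [Subsingleton.elim i 0]
  simp [h]

lemma pathE_succ (P : Matrix D D ℝ) (ν : D → ℝ) (m : ℕ) (G : (Fin (m + 2) → D) → ℝ) :
    pathE P ν (m + 1) G = ∑ x, ν x * pathE P (P x) m fun y => G (Fin.cons x y) := by
  unfold pathE
  rw [← (Fin.consEquiv fun _ : Fin (m + 2) => D).sum_comp, Fintype.sum_prod_type]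
  refine Finset.sum_congr rfl fun x _ => ?_
  rw [Finset.mul_sum]
  refine Finset.sum_congr rfl fun y _ => ?_
  simp [Fin.consEquiv, Fin.prod_univ_succ]
  ring

lemma pathE_const_mul (P : Matrix D D ℝ) (ν : D → ℝ) (m : ℕ) (c : ℝ)
    (G : (Fin (m + 1) → D) → ℝ) :
    pathE P ν m (fun x => c * G x) = c * pathE P ν m G := by
  unfold pathE
  rw [Finset.mul_sum]
  exact Finset.sum_congr rfl fun x _ => by ring

lemma pathE_sum {ι : Type*} (s : Finset ι) (P : Matrix D D ℝ) (ν : D → ℝ) (m : ℕ)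
    (G : ι → (Fin (m + 1) → D) → ℝ) :
    pathE P ν m (fun x => ∑ i ∈ s, G i x) = ∑ i ∈ s, pathE P ν m (G i) := by
  unfold pathE
  rw [Finset.sum_comm]
  exact Finset.sum_congr rfl fun x _ => Finset.mul_sum ..

lemma pathE_const {P : Matrix D D ℝ} (hP1 : ∀ x, ∑ y, P x y = 1) (ν : D → ℝ) (m : ℕ) (c : ℝ) :
    pathE P ν m (fun _ => c) = ∑ x, ν x * c := by
  induction m generalizing ν with
  | zero => exact pathE_zero ..
  | succ m ih =>
    rw [pathE_succ]
    exact Finset.sum_congr rfl fun x _ => by rw [ih, ← Finset.sum_mul, hP1, one_mul]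

open Matrix

variable [DecidableEq D]

lemma pathE_apply {P : Matrix D D ℝ} (hP1 : ∀ x, ∑ y, P x y = 1) (ν : D → ℝ) (m : ℕ)
    (ψ : D → ℝ) (j : Fin (m + 1)) :
    pathE P ν m (fun x => ψ (x j)) = ν ⬝ᵥ ((P ^ (j : ℕ)) *ᵥ ψ) := by
  induction m generalizing ν with
  | zero =>
    rw [pathE_zero, Fin.fin_one_eq_zero j]
    simp [dotProduct]
  | succ m ih =>
    rw [pathE_succ]
    refine j.cases ?_ fun j => ?_
    · simp [pathE_const hP1, dotProduct, ← Finset.sum_mul, hP1]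
    · simp only [Fin.cons_succ, ih, Fin.val_succ, pow_succ', ← mulVec_mulVec]
      rfl

/-- The joint law of two coordinates of the chain. -/
lemma pathE_apply_mul_apply {P : Matrix D D ℝ} (hP1 : ∀ x, ∑ y, P x y = 1) (ν : D → ℝ) (m : ℕ)
    (φ ψ : D → ℝ) {i j : Fin (m + 1)} (hij : i ≤ j) :
    pathE P ν m (fun x => φ (x i) * ψ (x j)) =
      ν ⬝ᵥ ((P ^ (i : ℕ)) *ᵥ (φ * ((P ^ ((j : ℕ) - i)) *ᵥ ψ))) := by
  induction m generalizing ν with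
  | zero =>
    rw [pathE_zero, Fin.fin_one_eq_zero j, Fin.fin_one_eq_zero i]
    simp [dotProduct]
  | succ m ih =>
    rw [pathE_succ]
    induction i using Fin.cases with
    | zero =>
      induction j using Fin.cases with
      | zero => simp [pathE_const hP1, dotProduct, ← Finset.sum_mul, hP1]
      | succ j =>
        simp only [Fin.cons_succ, Fin.cons_zero, pathE_const_mul, pathE_apply hP1, Fin.val_succ,
          Fin.val_zero, pow_zero, one_mulVec, Nat.sub_zero, pow_succ', ← mulVec_mulVec]
        rfl
    | succ i =>
      induction j using Fin.cases with
      | zero => simp at hij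
      | succ j =>
        simp only [Fin.cons_succ, ih _ (Fin.succ_le_succ_iff.1 hij), Fin.val_succ,
          Nat.add_sub_add_right, pow_succ' P (i : ℕ), ← mulVec_mulVec]
        rfl

end PathExpectation

section DoubleSums

lemma sum_range_sum_range_min_sub (F : ℕ → ℕ → ℝ) (n : ℕ) :
    ∑ i ∈ range n, ∑ j ∈ range n, F (min i j) (max i j - min i j) =
      ∑ i ∈ range n, (F i 0 + 2 * ∑ d ∈ range (n - 1 - i), F i (d + 1)) := by
  induction n with
  | zero => simp
  | succ n ih =>
    have h₁ : ∀ i ∈ range n, ∑ d ∈ range (n - i), F i (d + 1) =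
        ∑ d ∈ range (n - 1 - i), F i (d + 1) + F i (n - i) := by
      intro i hi
      have hi := Finset.mem_range.1 hi
      obtain ⟨k, rfl⟩ : ∃ k, n = i + k + 1 := ⟨n - 1 - i, by omega⟩
      rw [show i + k + 1 - i = k + 1 by omega, show i + k + 1 - 1 - i = k by omega,
        Finset.sum_range_succ]
    have h₂ : ∀ i ∈ range n, F (min i n) (max i n - min i n) = F i (n - i) := by
      intro i hi
      have hi := (Finset.mem_range.1 hi).le
      rw [min_eq_left hi, max_eq_right hi]
    have h₃ : ∀ i ∈ range n, F (min n i) (max n i - min n i) = F i (n - i) := by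
      intro i hi
      rw [min_comm, max_comm, h₂ i hi]
    simp only [Finset.sum_range_succ, Finset.sum_add_distrib, ih, Finset.sum_congr rfl h₂,
      Finset.sum_congr rfl h₃, Nat.add_sub_cancel, ← Finset.mul_sum, Finset.sum_congr rfl h₁]
    simp
    ring

lemma one_add_two_mul_sum_pow {t : ℝ} (ht : t < 1) (m : ℕ) :
    1 + 2 * ∑ d ∈ range m, t ^ (d + 1) = (1 + t - 2 * t ^ (m + 1)) / (1 - t) := by
  have h : t - 1 ≠ 0 := by linarith
  have h' : 1 - t ≠ 0 := by linarith
  simp only [pow_succ t, ← Finset.sum_mul, geom_sum_eq ht.ne]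
  field_simp
  ring

lemma one_add_two_mul_sum_pow_le {t : ℝ} (h₁ : -1 ≤ t) (ht : t < 1) (m : ℕ) :
    1 + 2 * ∑ d ∈ range m, t ^ (d + 1) ≤ 2 / (1 - t) := by
  rw [one_add_two_mul_sum_pow ht]
  have h' : 0 < 1 - t := by linarith
  gcongr
  rcases le_total 0 t with h | h
  · have := pow_nonneg h (m + 1)
    linarith
  · have h₂ : |t ^ (m + 1)| ≤ |t| := by
      rw [abs_pow, pow_succ]
      exact mul_le_of_le_one_left (abs_nonneg t)
        (pow_le_one₀ (abs_nonneg t) (abs_le.2 ⟨h₁, ht.le⟩))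
    rw [abs_of_nonpos h] at h₂
    linarith [(abs_le.1 h₂).1]

lemma tendsto_cesaro_one_add_two_mul_sum_pow {t : ℝ} (ht : |t| < 1) :
    Filter.Tendsto
      (fun n : ℕ => (n : ℝ)⁻¹ * ∑ i ∈ range n, (1 + 2 * ∑ d ∈ range i, t ^ (d + 1)))
      Filter.atTop (nhds ((1 + t) / (1 - t))) := by
  refine Filter.Tendsto.cesaro ?_
  simp only [one_add_two_mul_sum_pow (abs_lt.1 ht).2]
  have h : Filter.Tendsto (fun m : ℕ => t ^ (m + 1)) Filter.atTop (nhds 0) :=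
    (tendsto_pow_atTop_nhds_zero_of_abs_lt_one ht).comp (Filter.tendsto_add_atTop_nat 1)
  simpa using ((h.const_mul 2).const_sub (1 + t)).div_const (1 - t)

end DoubleSums

section Spectral

open Matrix

variable {D : Type*} [Fintype D] [DecidableEq D] {P : Matrix D D ℝ} {π : D → ℝ}

lemma reversible_pow (hrev : ∀ x y, π x * P x y = π y * P y x) (d : ℕ) (x y : D) :
    π x * (P ^ d) x y = π y * (P ^ d) y x := by
  induction d generalizing x y with
  | zero =>
    rcases eq_or_ne x y with rfl | h
    · rfl
    · simp [one_apply_ne h, one_apply_ne h.symm]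
  | succ d ih =>
    rw [pow_succ, mul_apply, ← pow_succ, pow_succ', mul_apply, Finset.mul_sum, Finset.mul_sum]
    refine Finset.sum_congr rfl fun z _ => ?_
    rw [← mul_assoc, ih, mul_right_comm, hrev]
    ring

lemma sum_pow_mulVec_mul (hrev : ∀ x y, π x * P x y = π y * P y x) (d : ℕ) (φ ψ : D → ℝ) :
    ∑ x, ((P ^ d) *ᵥ φ) x * ψ x * π x = ∑ x, φ x * ((P ^ d) *ᵥ ψ) x * π x := by
  simp only [mulVec, dotProduct, Finset.sum_mul, Finset.mul_sum]
  rw [Finset.sum_comm]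
  refine Finset.sum_congr rfl fun y _ => Finset.sum_congr rfl fun x _ => ?_
  linear_combination φ y * ψ x * reversible_pow hrev d x y

lemma pow_mulVec_eigenvector {v : D → ℝ} {c : ℝ} (h : ∀ x, ∑ y, P x y * v y = c * v x) (d : ℕ) :
    (P ^ d) *ᵥ v = c ^ d • v := by
  induction d with
  | zero => simp
  | succ d ih =>
    have h' : P *ᵥ v = c • v := funext h
    rw [pow_succ, ← mulVec_mulVec, h', mulVec_smul, ih, smul_smul, pow_succ']

lemma sum_pow_mulVec_mul_eigenvector (hrev : ∀ x y, π x * P x y = π y * P y x) {v : D → ℝ} {c : ℝ}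
    (h : ∀ x, ∑ y, P x y * v y = c * v x) (d : ℕ) (φ : D → ℝ) :
    ∑ x, ((P ^ d) *ᵥ φ) x * v x * π x = c ^ d * ∑ x, φ x * v x * π x := by
  rw [sum_pow_mulVec_mul hrev, pow_mulVec_eigenvector h, Finset.mul_sum]
  exact Finset.sum_congr rfl fun x _ => by simp only [Pi.smul_apply, smul_eq_mul]; ring

variable {ι : Type*} [Fintype ι] [DecidableEq ι] {u : ι → D → ℝ}

lemma sum_orthonormal_mul_self (hcard : Fintype.card ι = Fintype.card D)
    (horth : ∀ k l, (∑ x, u k x * u l x * π x) = if k = l then 1 else 0) (x y : D) :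
    ∑ k, u k x * u k y * π y = if x = y then 1 else 0 := by
  have h : (of u : Matrix ι D ℝ) * (of fun x k => u k x * π x : Matrix D ι ℝ) = 1 := by
    ext k l
    simp only [mul_apply, of_apply, one_apply, ← horth, mul_assoc]
  have h' := congrFun₂ ((mul_eq_one_comm_of_equiv (Fintype.equivOfCardEq hcard)).1 h) y x
  simp only [mul_apply, of_apply, one_apply, eq_comm (a := y)] at h'
  rw [← h']
  exact Finset.sum_congr rfl fun k _ => by ring

lemma parseval (hcard : Fintype.card ι = Fintype.card D)
    (horth : ∀ k l, (∑ x, u k x * u l x * π x) = if k = l then 1 else 0) (φ ψ : D → ℝ) :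
    ∑ x, φ x * ψ x * π x =
      ∑ k, (∑ x, φ x * u k x * π x) * ∑ x, ψ x * u k x * π x := by
  simp only [Finset.sum_mul_sum]
  rw [Finset.sum_comm]
  refine Finset.sum_congr rfl fun x _ => ?_
  rw [Finset.sum_comm]
  have h : ∀ y, ∑ k, φ x * u k x * π x * (ψ y * u k y * π y) =
      φ x * π x * ψ y * if x = y then 1 else 0 := by
    intro y
    rw [← sum_orthonormal_mul_self hcard horth, Finset.mul_sum]
    exact Finset.sum_congr rfl fun k _ => by ring
  simp only [h]
  simp
  ring

variable {β : ι → ℝ}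

lemma sum_mul_pow_mulVec_eq (hcard : Fintype.card ι = Fintype.card D)
    (horth : ∀ k l, (∑ x, u k x * u l x * π x) = if k = l then 1 else 0)
    (hrev : ∀ x y, π x * P x y = π y * P y x)
    (heig : ∀ k x, ∑ y, P x y * u k y = β k * u k x) (d : ℕ) (φ : D → ℝ) :
    ∑ x, φ x * ((P ^ d) *ᵥ φ) x * π x = ∑ k, (∑ x, φ x * u k x * π x) ^ 2 * β k ^ d := by
  rw [parseval hcard horth]
  exact Finset.sum_congr rfl fun k _ => by
    rw [sum_pow_mulVec_mul_eigenvector hrev (heig k)]; ring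

lemma sum_pow_mulVec_sq_le (hcard : Fintype.card ι = Fintype.card D)
    (horth : ∀ k l, (∑ x, u k x * u l x * π x) = if k = l then 1 else 0)
    (hrev : ∀ x y, π x * P x y = π y * P y x)
    (heig : ∀ k x, ∑ y, P x y * u k y = β k * u k x) {k₀ : ι} {b : ℝ}
    (hb : ∀ k, k ≠ k₀ → |β k| ≤ b) (d : ℕ) {φ : D → ℝ} (hφ : ∑ x, φ x * u k₀ x * π x = 0) :
    ∑ x, ((P ^ d) *ᵥ φ) x ^ 2 * π x ≤ (b ^ d) ^ 2 * ∑ x, φ x ^ 2 * π x := by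
  simp only [sq]
  rw [parseval hcard horth, parseval hcard horth φ, Finset.mul_sum]
  refine Finset.sum_le_sum fun k _ => ?_
  rw [sum_pow_mulVec_mul_eigenvector hrev (heig k)]
  rcases eq_or_ne k k₀ with rfl | hk
  · simp [hφ]
  · rw [mul_mul_mul_comm]
    refine mul_le_mul_of_nonneg_right ?_ (mul_self_nonneg _)
    rw [← abs_mul_abs_self (β k ^ d), abs_pow]
    have := pow_le_pow_left₀ (abs_nonneg _) (hb k hk) d
    exact mul_self_le_mul_self (by positivity) this

end Spectral

section Weighted

variable {D : Type*} [Fintype D] {π : D → ℝ}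

lemma abs_le_sqrt_iSup_mul_sqrt (hπ : ∀ x, 0 < π x) (φ : D → ℝ) (x : D) :
    |φ x| ≤ √(⨆ x, 1 / π x) * √(∑ x, φ x ^ 2 * π x) := by
  have h₁ : 1 / π x ≤ ⨆ x, 1 / π x := le_ciSup (Set.finite_range fun x => 1 / π x).bddAbove x
  have h₂ : φ x ^ 2 * π x ≤ ∑ x, φ x ^ 2 * π x :=
    Finset.single_le_sum (f := fun x => φ x ^ 2 * π x)
      (fun y _ => mul_nonneg (sq_nonneg _) (hπ y).le) (Finset.mem_univ x)
  have h₃ : 0 ≤ 1 / π x := (one_div_pos.2 (hπ x)).le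
  rw [← Real.sqrt_mul (h₃.trans h₁)]
  refine Real.abs_le_sqrt ?_
  calc φ x ^ 2 = 1 / π x * (φ x ^ 2 * π x) := by field_simp [(hπ x).ne']
    _ ≤ _ := mul_le_mul h₁ h₂ (mul_nonneg (sq_nonneg _) (hπ x).le) (h₃.trans h₁)

lemma sum_abs_mul_abs_mul_le (hπ : ∀ x, 0 < π x) (φ ψ : D → ℝ) :
    ∑ x, |φ x| * |ψ x| * π x ≤ √(∑ x, φ x ^ 2 * π x) * √(∑ x, ψ x ^ 2 * π x) := by
  have h := Real.sum_mul_le_sqrt_mul_sqrt Finset.univ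
    (fun x => |φ x| * √(π x)) fun x => |ψ x| * √(π x)
  simp only [mul_pow, sq_abs, Real.sq_sqrt (hπ _).le] at h
  refine (Finset.sum_congr rfl fun x _ => ?_).trans_le h
  rw [mul_mul_mul_comm, Real.mul_self_sqrt (hπ x).le]

lemma abs_sum_mul_mul_mul_le (hπ : ∀ x, 0 < π x) (ε φ ψ : D → ℝ) :
    |∑ x, ε x * (φ x * ψ x) * π x| ≤ √(⨆ x, 1 / π x) * √(∑ x, ε x ^ 2 * π x) *
      (√(∑ x, φ x ^ 2 * π x) * √(∑ x, ψ x ^ 2 * π x)) := by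
  refine (Finset.abs_sum_le_sum_abs _ _).trans ?_
  calc ∑ x, |ε x * (φ x * ψ x) * π x|
      = ∑ x, |ε x| * (|φ x| * |ψ x| * π x) := by
        simp only [abs_mul, abs_of_pos (hπ _), mul_assoc]
    _ ≤ ∑ x, √(⨆ x, 1 / π x) * √(∑ x, ε x ^ 2 * π x) * (|φ x| * |ψ x| * π x) :=
        Finset.sum_le_sum fun x _ => mul_le_mul_of_nonneg_right
          (abs_le_sqrt_iSup_mul_sqrt hπ ε x) (by have := (hπ x).le; positivity)
    _ ≤ _ := by
        rw [← Finset.mul_sum]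
        gcongr
        exact sum_abs_mul_abs_mul_le hπ φ ψ

lemma sum_sub_mean_mul_eigenvector {ι : Type*} [DecidableEq ι] {u : ι → D → ℝ} {k₀ : ι}
    (horth : ∀ k l, (∑ x, u k x * u l x * π x) = if k = l then 1 else 0)
    (hu0 : ∀ x, u k₀ x = 1) (f : D → ℝ) (k : ι) :
    ∑ x, (f x - ∑ y, f y * π y) * u k x * π x =
      if k = k₀ then 0 else ∑ x, f x * u k x * π x := by
  have h := horth k k₀
  simp only [hu0, mul_one] at h
  have h' : ∑ x, (f x - ∑ y, f y * π y) * u k x * π x =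
      ∑ x, f x * u k x * π x - (∑ y, f y * π y) * ∑ x, u k x * π x := by
    rw [Finset.mul_sum, ← Finset.sum_sub_distrib]
    exact Finset.sum_congr rfl fun x _ => by ring
  rw [h', h]
  split_ifs with hk
  · simp [hk, hu0]
  · simp

end Weighted

section MeanSquareError

open Matrix

lemma sum_range_pow_mul_one_add_le {b : ℝ} (h₀ : 0 ≤ b) (h₁ : b < 1) (n : ℕ) :
    ∑ i ∈ range n, b ^ i * (1 + 2 * ∑ d ∈ range (n - 1 - i), b ^ (d + 1)) ≤ 2 / (1 - b) ^ 2 := by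
  have h : 0 < 1 - b := by linarith
  calc _ ≤ ∑ i ∈ range n, b ^ i * (2 / (1 - b)) := by
        gcongr
        exact one_add_two_mul_sum_pow_le (by linarith) h₁ _
    _ = 2 * ((1 - b) * ∑ i ∈ range n, b ^ i) / (1 - b) ^ 2 := by
        rw [← Finset.sum_mul]
        field_simp
    _ ≤ 2 / (1 - b) ^ 2 := by
        rw [mul_neg_geom_sum]
        gcongr
        linarith [pow_nonneg h₀ n]

variable {D : Type*} [Fintype D] [DecidableEq D] {P : Matrix D D ℝ} {π : D → ℝ}

lemma pathE_apply_mul_apply_self (hP1 : ∀ x, ∑ y, P x y = 1) (ν : D → ℝ) (m : ℕ)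
    (φ : D → ℝ) (i j : Fin (m + 1)) :
    pathE P ν m (fun x => φ (x i) * φ (x j)) =
      ν ⬝ᵥ ((P ^ min (i : ℕ) j) *ᵥ (φ * ((P ^ (max (i : ℕ) j - min (i : ℕ) j)) *ᵥ φ))) := by
  rcases le_total i j with h | h
  · rw [min_eq_left (Fin.le_def.1 h), max_eq_right (Fin.le_def.1 h),
      pathE_apply_mul_apply hP1 _ _ _ _ h]
  · rw [min_eq_right (Fin.le_def.1 h), max_eq_left (Fin.le_def.1 h),
      ← pathE_apply_mul_apply hP1 _ _ _ _ h]
    simp only [mul_comm]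

lemma sq_mul_mse (hP1 : ∀ x, ∑ y, P x y = 1) (ν f g : D → ℝ) {n : ℕ} (hn : 1 ≤ n) (n₀ : ℕ)
    (hg : ∀ x, g x = f x - ∑ y, f y * π y) :
    (n : ℝ) ^ 2 * mse P π ν f n n₀ =
      ∑ i ∈ range n, (ν ⬝ᵥ ((P ^ (n₀ + i)) *ᵥ (g * ((P ^ 0) *ᵥ g))) +
        2 * ∑ d ∈ range (n - 1 - i), ν ⬝ᵥ ((P ^ (n₀ + i)) *ᵥ (g * ((P ^ (d + 1)) *ᵥ g)))) := by
  have hn0 : (n : ℝ) ≠ 0 := by positivity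
  have h : ∀ x : Fin (n₀ + n + 1) → D,
      (n : ℝ) ^ 2 * ((∑ j : Fin n, f (x (Fin.castSucc (Fin.natAdd n₀ j)))) / (n : ℝ)
        - ∑ y, f y * π y) ^ 2 =
      ∑ i : Fin n, ∑ j : Fin n, g (x (Fin.castSucc (Fin.natAdd n₀ i))) *
        g (x (Fin.castSucc (Fin.natAdd n₀ j))) := by
    intro x
    rw [← Finset.sum_mul_sum, ← sq, ← mul_pow]
    simp only [hg, Finset.sum_sub_distrib]
    congr 1
    simp
    field_simp
  unfold mse
  rw [← pathE_const_mul]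
  simp only [h, pathE_sum, pathE_apply_mul_apply_self hP1, Fin.val_castSucc, Fin.val_natAdd,
    Nat.add_min_add_left, Nat.add_max_add_left, Nat.add_sub_add_left]
  rw [← sum_range_sum_range_min_sub
    (fun i d => ν ⬝ᵥ ((P ^ (n₀ + i)) *ᵥ (g * ((P ^ d) *ᵥ g)))) n, ← Fin.sum_univ_eq_sum_range
    (fun i => ∑ j ∈ range n, ν ⬝ᵥ ((P ^ (n₀ + min i j)) *ᵥ
      (g * ((P ^ (max i j - min i j)) *ᵥ g))))]
  refine Finset.sum_congr rfl fun i _ => ?_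
  rw [← Fin.sum_univ_eq_sum_range
    (fun j => ν ⬝ᵥ ((P ^ (n₀ + min (i : ℕ) j)) *ᵥ
      (g * ((P ^ (max (i : ℕ) j - min (i : ℕ) j)) *ᵥ g))))]

lemma dotProduct_pow_mulVec (hπ : ∀ x, 0 < π x) (hP1 : ∀ x, ∑ y, P x y = 1)
    (hrev : ∀ x y, π x * P x y = π y * P y x) (ν w : D → ℝ) (m : ℕ) :
    ν ⬝ᵥ ((P ^ m) *ᵥ w) =
      ∑ x, w x * π x + ∑ x, ((P ^ m) *ᵥ fun y => ν y / π y - 1) x * w x * π x := by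
  have h₁ := sum_pow_mulVec_mul_eigenvector hrev (v := fun _ => 1) (c := 1) (by simp [hP1]) m w
  simp only [mul_one, one_pow, one_mul] at h₁
  rw [sum_pow_mulVec_mul hrev, ← h₁, ← Finset.sum_add_distrib]
  refine Finset.sum_congr rfl fun x _ => ?_
  have := (hπ x).ne'
  field_simp
  ring

variable {ι : Type*} [Fintype ι] [DecidableEq ι] {u : ι → D → ℝ} {β : ι → ℝ} {k₀ : ι} {b : ℝ}

lemma sum_erase_sq_le (hcard : Fintype.card ι = Fintype.card D)
    (horth : ∀ k l, (∑ x, u k x * u l x * π x) = if k = l then 1 else 0) (f : D → ℝ) (k₀ : ι) :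
    ∑ k ∈ univ.erase k₀, (∑ x, f x * u k x * π x) ^ 2 ≤ ∑ x, f x ^ 2 * π x := by
  have h := parseval hcard horth f f
  simp only [← sq] at h
  rw [h]
  exact Finset.sum_le_sum_of_subset_of_nonneg (Finset.erase_subset _ _)
    fun _ _ _ => sq_nonneg _

/-- The mean square error differs from its stationary spectral expansion by a term of order
`n⁻²`, which is exponentially small in the burn-in `n₀`. -/
lemma abs_sq_mul_mse_sub_le (hcard : Fintype.card ι = Fintype.card D)
    (hP1 : ∀ x, ∑ y, P x y = 1) (hπ : ∀ x, 0 < π x) (hπ1 : ∑ x, π x = 1)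
    (hrev : ∀ x y, π x * P x y = π y * P y x)
    (heig : ∀ k x, ∑ y, P x y * u k y = β k * u k x)
    (horth : ∀ k l, (∑ x, u k x * u l x * π x) = if k = l then 1 else 0)
    (hu0 : ∀ x, u k₀ x = 1) (hb : ∀ k, k ≠ k₀ → |β k| ≤ b) (hb0 : 0 ≤ b) (hb1 : b < 1)
    {ν : D → ℝ} (hν1 : ∑ x, ν x = 1) (f : D → ℝ) {n : ℕ} (hn : 1 ≤ n) (n₀ : ℕ) :
    |(n : ℝ) ^ 2 * mse P π ν f n n₀ - ∑ k ∈ univ.erase k₀, (∑ x, f x * u k x * π x) ^ 2 *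
        ∑ i ∈ range n, (1 + 2 * ∑ d ∈ range i, β k ^ (d + 1))| ≤
      2 * b ^ n₀ * √(⨆ x, 1 / π x) * √(∑ x, (ν x / π x - 1) ^ 2 * π x) *
        (∑ x, f x ^ 2 * π x) / (1 - b) ^ 2 := by
  set g : D → ℝ := fun x => f x - ∑ y, f y * π y
  set ε : D → ℝ := fun x => ν x / π x - 1 with hε
  set V : ℕ → ℝ := fun d => ∑ k ∈ univ.erase k₀, (∑ x, f x * u k x * π x) ^ 2 * β k ^ d with hV
  set R : ℕ → ℕ → ℝ := fun i d =>
    ∑ x, ((P ^ (n₀ + i)) *ᵥ ε) x * (g x * ((P ^ d) *ᵥ g) x) * π x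
  set C := √(⨆ x, 1 / π x) * √(∑ x, ε x ^ 2 * π x) * ∑ x, f x ^ 2 * π x with hC
  have hcoef : ∀ k, ∑ x, g x * u k x * π x = if k = k₀ then 0 else ∑ x, f x * u k x * π x :=
    sum_sub_mean_mul_eigenvector horth hu0 f
  have hstat : ∀ d, ∑ x, g x * ((P ^ d) *ᵥ g) x * π x = V d := by
    intro d
    rw [sum_mul_pow_mulVec_eq hcard horth hrev heig, ← Finset.add_sum_erase _ _ (mem_univ k₀)]
    simp only [hcoef, if_true, hV]
    rw [zero_pow two_ne_zero, zero_mul, zero_add]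
    exact Finset.sum_congr rfl fun k hk => by rw [if_neg (Finset.ne_of_mem_erase hk)]
  have hgf : ∑ x, g x ^ 2 * π x ≤ ∑ x, f x ^ 2 * π x := by
    refine le_trans (le_of_eq ?_) (sum_erase_sq_le hcard horth f k₀)
    simpa [sq, hV] using hstat 0
  have hF : ∀ i d, ν ⬝ᵥ ((P ^ (n₀ + i)) *ᵥ (g * ((P ^ d) *ᵥ g))) = V d + R i d := by
    intro i d
    rw [dotProduct_pow_mulVec hπ hP1 hrev, ← hstat]
    rfl
  have hεmean : ∑ x, ε x * u k₀ x * π x = 0 := by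
    have : ∀ x, ε x * u k₀ x * π x = ν x - π x := fun x => by
      have := (hπ x).ne'
      simp only [hε, hu0]
      field_simp
    simp only [this, Finset.sum_sub_distrib, hν1, hπ1, sub_self]
  have hgmean : ∑ x, g x * u k₀ x * π x = 0 := by rw [hcoef, if_pos rfl]
  have hnorm : ∀ {φ : D → ℝ}, ∑ x, φ x * u k₀ x * π x = 0 → ∀ d,
      √(∑ x, ((P ^ d) *ᵥ φ) x ^ 2 * π x) ≤ b ^ d * √(∑ x, φ x ^ 2 * π x) := by
    intro φ hφ d
    refine (Real.sqrt_le_sqrt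
      (sum_pow_mulVec_sq_le hcard horth hrev heig hb d hφ)).trans_eq ?_
    rw [Real.sqrt_mul (sq_nonneg _), Real.sqrt_sq (pow_nonneg hb0 d)]
  have hg0 : 0 ≤ ∑ x, g x ^ 2 * π x :=
    Finset.sum_nonneg fun x _ => mul_nonneg (sq_nonneg _) (hπ x).le
  have hRle : ∀ i d, |R i d| ≤ b ^ n₀ * C * (b ^ i * b ^ d) := by
    intro i d
    calc |R i d| ≤ √(⨆ x, 1 / π x) * √(∑ x, ((P ^ (n₀ + i)) *ᵥ ε) x ^ 2 * π x) *
          (√(∑ x, g x ^ 2 * π x) * √(∑ x, ((P ^ d) *ᵥ g) x ^ 2 * π x)) :=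
          abs_sum_mul_mul_mul_le hπ _ _ _
      _ ≤ √(⨆ x, 1 / π x) * (b ^ (n₀ + i) * √(∑ x, ε x ^ 2 * π x)) *
          (√(∑ x, g x ^ 2 * π x) * (b ^ d * √(∑ x, g x ^ 2 * π x))) := by
          gcongr
          · exact hnorm hεmean _
          · exact hnorm hgmean _
      _ = √(⨆ x, 1 / π x) * √(∑ x, ε x ^ 2 * π x) * (√(∑ x, g x ^ 2 * π x) ^ 2) *
          (b ^ (n₀ + i) * b ^ d) := by ring
      _ ≤ √(⨆ x, 1 / π x) * √(∑ x, ε x ^ 2 * π x) * (∑ x, f x ^ 2 * π x) *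
          (b ^ (n₀ + i) * b ^ d) := by
          rw [Real.sq_sqrt hg0]
          gcongr
      _ = b ^ n₀ * C * (b ^ i * b ^ d) := by rw [hC, pow_add]; ring
  have hVsum : ∑ i ∈ range n, (V 0 + 2 * ∑ d ∈ range (n - 1 - i), V (d + 1)) =
      ∑ k ∈ univ.erase k₀, (∑ x, f x * u k x * π x) ^ 2 *
        ∑ i ∈ range n, (1 + 2 * ∑ d ∈ range i, β k ^ (d + 1)) := by
    rw [Finset.sum_range_reflect (fun i => V 0 + 2 * ∑ d ∈ range i, V (d + 1))]
    simp only [Finset.mul_sum (range n)]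
    rw [Finset.sum_comm]
    refine Finset.sum_congr rfl fun i _ => ?_
    simp only [hV, pow_zero, mul_one]
    rw [Finset.sum_comm, Finset.mul_sum, ← Finset.sum_add_distrib]
    refine Finset.sum_congr rfl fun k _ => ?_
    rw [← Finset.mul_sum]
    ring
  have hsplit : (n : ℝ) ^ 2 * mse P π ν f n n₀ -
      ∑ i ∈ range n, (V 0 + 2 * ∑ d ∈ range (n - 1 - i), V (d + 1)) =
      ∑ i ∈ range n, (R i 0 + 2 * ∑ d ∈ range (n - 1 - i), R i (d + 1)) := by
    rw [sq_mul_mse hP1 ν f g hn n₀ fun _ => rfl, ← Finset.sum_sub_distrib]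
    refine Finset.sum_congr rfl fun i _ => ?_
    simp only [hF, Finset.sum_add_distrib]
    ring
  rw [← hVsum, hsplit]
  calc _ ≤ ∑ i ∈ range n, (|R i 0| + 2 * ∑ d ∈ range (n - 1 - i), |R i (d + 1)|) := by
        refine (Finset.abs_sum_le_sum_abs _ _).trans (Finset.sum_le_sum fun i _ => ?_)
        refine (abs_add_le _ _).trans ?_
        rw [abs_mul, abs_two]
        gcongr
        exact Finset.abs_sum_le_sum_abs _ _
    _ ≤ ∑ i ∈ range n, (b ^ n₀ * C * (b ^ i * b ^ 0) +
          2 * ∑ d ∈ range (n - 1 - i), b ^ n₀ * C * (b ^ i * b ^ (d + 1))) := by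
        gcongr <;> exact hRle _ _
    _ = b ^ n₀ * C *
          ∑ i ∈ range n, b ^ i * (1 + 2 * ∑ d ∈ range (n - 1 - i), b ^ (d + 1)) := by
        rw [Finset.mul_sum]
        refine Finset.sum_congr rfl fun i _ => ?_
        simp only [← Finset.mul_sum]
        ring
    _ ≤ b ^ n₀ * C * (2 / (1 - b) ^ 2) := by
        have : 0 ≤ C := by have := hg0.trans hgf; positivity
        gcongr
        exact sum_range_pow_mul_one_add_le hb0 hb1 n
    _ = _ := by rw [hC]; ring

lemma tendsto_mul_mse (hcard : Fintype.card ι = Fintype.card D)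
    (hP1 : ∀ x, ∑ y, P x y = 1) (hπ : ∀ x, 0 < π x) (hπ1 : ∑ x, π x = 1)
    (hrev : ∀ x y, π x * P x y = π y * P y x)
    (heig : ∀ k x, ∑ y, P x y * u k y = β k * u k x)
    (horth : ∀ k l, (∑ x, u k x * u l x * π x) = if k = l then 1 else 0)
    (hu0 : ∀ x, u k₀ x = 1) (hb : ∀ k, k ≠ k₀ → |β k| ≤ b) (hb0 : 0 ≤ b) (hb1 : b < 1)
    {ν : D → ℝ} (hν1 : ∑ x, ν x = 1) (f : D → ℝ) (n₀ : ℕ) :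
    Filter.Tendsto (fun n : ℕ => (n : ℝ) * mse P π ν f n n₀) Filter.atTop
      (nhds (∑ k ∈ univ.erase k₀,
        (∑ x, f x * u k x * π x) ^ 2 * ((1 + β k) / (1 - β k)))) := by
  set K := 2 * b ^ n₀ * √(⨆ x, 1 / π x) * √(∑ x, (ν x / π x - 1) ^ 2 * π x) *
    (∑ x, f x ^ 2 * π x) / (1 - b) ^ 2
  have hlim : Filter.Tendsto (fun n : ℕ => ∑ k ∈ univ.erase k₀, (∑ x, f x * u k x * π x) ^ 2 *
      ((n : ℝ)⁻¹ * ∑ i ∈ range n, (1 + 2 * ∑ d ∈ range i, β k ^ (d + 1)))) Filter.atTop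
      (nhds (∑ k ∈ univ.erase k₀,
        (∑ x, f x * u k x * π x) ^ 2 * ((1 + β k) / (1 - β k)))) :=
    tendsto_finsetSum _ fun k hk => (tendsto_cesaro_one_add_two_mul_sum_pow
      ((hb k (Finset.ne_of_mem_erase hk)).trans_lt hb1)).const_mul _
  refine hlim.congr_dist ?_
  refine squeeze_zero' (.of_forall fun _ => dist_nonneg) ?_
    (tendsto_const_div_atTop_nhds_zero_nat K)
  filter_upwards [Filter.eventually_ge_atTop 1] with n hn
  have hn' : (0 : ℝ) < n := by positivity
  have h := abs_sq_mul_mse_sub_le hcard hP1 hπ hπ1 hrev heig horth hu0 hb hb0 hb1 hν1 f hn n₀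
  rw [dist_comm, Real.dist_eq, le_div_iff₀ hn', ← abs_of_pos hn', ← abs_mul, abs_of_pos hn']
  refine le_trans (le_of_eq ?_) h
  congr 1
  simp only [mul_left_comm _ (n : ℝ)⁻¹, ← Finset.mul_sum]
  field_simp

end MeanSquareError

/-- Theorem (main finite error bound): for a reversible `P` with second largest
eigenvalue `β₁`, second largest absolute eigenvalue `β < 1` and any initial
distribution `ν`,
`e_ν(S_{n,n₀},f)² ≤ 2‖f‖₂²/(n(1−β₁)) + 2βⁿ⁰√(‖1/π‖_∞)‖ν/π−1‖₂‖f‖₂²/(n²(1−β)²)`, and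
`lim_n n·e_ν(S_{n,n₀},f)² = lim_n n·e_π(S_n,f)² = Σ_{k=1}^{|D|−1} a_k²(1+β_k)/(1−β_k)`
with `a_k = ⟨f,u_k⟩`. -/
theorem stmt7 {D : Type*} [Fintype D] [DecidableEq D] [Nonempty D]
    (P : Matrix D D ℝ) (π ν : D → ℝ)
    (hP0 : ∀ x y, 0 ≤ P x y) (hP1 : ∀ x, ∑ y, P x y = 1)
    (hπpos : ∀ x, 0 < π x) (hπ1 : ∑ x, π x = 1)
    (hrev : ∀ x y, π x * P x y = π y * P y x)
    (hν0 : ∀ x, 0 ≤ ν x) (hν1 : ∑ x, ν x = 1)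
    (hcard : 1 < Fintype.card D)
    (β : Fin (Fintype.card D) → ℝ) (u : Fin (Fintype.card D) → D → ℝ)
    (heig : ∀ k x, ∑ y, P x y * u k y = β k * u k x)
    (horth : ∀ k l, (∑ x, u k x * u l x * π x) = if k = l then 1 else 0)
    (hβ0 : β ⟨0, Fintype.card_pos⟩ = 1)
    (hu0 : ∀ x, u ⟨0, Fintype.card_pos⟩ x = 1)
    (hmono : ∀ k l, k ≤ l → β l ≤ β k)
    (hβtop : ∀ k, k ≠ (⟨0, Fintype.card_pos⟩ : Fin (Fintype.card D)) → β k < 1)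
    (hβbot : ∀ k, -1 ≤ β k)
    (b1 b : ℝ) (hb1 : b1 = β ⟨1, hcard⟩)
    (hb : b = max b1 |β ⟨Fintype.card D - 1, by omega⟩|) (hblt : b < 1)
    (f : D → ℝ) :
    (∀ n n₀ : ℕ, 1 ≤ n →
      mse P π ν f n n₀ ≤
        2 * (∑ x, f x ^ 2 * π x) / ((n : ℝ) * (1 - b1)) +
          2 * b ^ n₀ * Real.sqrt (⨆ x, 1 / π x) *
            Real.sqrt (∑ x, (ν x / π x - 1) ^ 2 * π x) * (∑ x, f x ^ 2 * π x) /
              ((n : ℝ) ^ 2 * (1 - b) ^ 2)) ∧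
    (∀ n₀ : ℕ,
      Filter.Tendsto (fun n : ℕ => (n : ℝ) * mse P π ν f n n₀) Filter.atTop
        (nhds (∑ k ∈ Finset.univ.erase (⟨0, Fintype.card_pos⟩ : Fin (Fintype.card D)),
          (∑ x, f x * u k x * π x) ^ 2 * ((1 + β k) / (1 - β k))))) ∧
    Filter.Tendsto (fun n : ℕ => (n : ℝ) * mse P π π f n 0) Filter.atTop
      (nhds (∑ k ∈ Finset.univ.erase (⟨0, Fintype.card_pos⟩ : Fin (Fintype.card D)),
        (∑ x, f x * u k x * π x) ^ 2 * ((1 + β k) / (1 - β k)))) := by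
  set k₀ : Fin (Fintype.card D) := ⟨0, Fintype.card_pos⟩
  have hcard' : Fintype.card (Fin (Fintype.card D)) = Fintype.card D := Fintype.card_fin _
  have hle : ∀ k, k ≠ k₀ → β k ≤ b1 := fun k hk => by
    rw [hb1]
    refine hmono _ _ (Fin.le_def.2 (Nat.one_le_iff_ne_zero.2 fun h => hk (Fin.ext h)))
  have habs : ∀ k, k ≠ k₀ → |β k| ≤ b := fun k hk => by
    refine abs_le.2 ⟨?_, (hle k hk).trans (hb ▸ le_max_left _ _)⟩
    have h := hmono k ⟨Fintype.card D - 1, by omega⟩ (Fin.le_def.2 (Nat.le_sub_one_of_lt k.2))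
    have h' := hb ▸ le_max_right b1 |β ⟨Fintype.card D - 1, by omega⟩|
    linarith [(abs_le.1 h').1]
  have hb0 : 0 ≤ b := hb ▸ (abs_nonneg _).trans (le_max_right _ _)
  have hb1lt : b1 < 1 := (hb ▸ le_max_left _ _ : b1 ≤ b).trans_lt hblt
  refine ⟨fun n n₀ hn => ?_, fun n₀ => tendsto_mul_mse hcard' hP1 hπpos hπ1 hrev heig horth hu0
    habs hb0 hblt hν1 f n₀, tendsto_mul_mse hcard' hP1 hπpos hπ1 hrev heig horth hu0
    habs hb0 hblt hπ1 f 0⟩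
  have hn' : (0 : ℝ) < n := by positivity
  have h1 : 0 < 1 - b1 := by linarith
  have h := (abs_le.1 (abs_sq_mul_mse_sub_le hcard' hP1 hπpos hπ1 hrev heig horth hu0 habs hb0 hblt
    hν1 f hn n₀)).2
  have hstat : ∑ k ∈ univ.erase k₀, (∑ x, f x * u k x * π x) ^ 2 *
      ∑ i ∈ range n, (1 + 2 * ∑ d ∈ range i, β k ^ (d + 1)) ≤
      (∑ x, f x ^ 2 * π x) * (n * (2 / (1 - b1))) := by
    refine le_trans ?_ (mul_le_mul_of_nonneg_right (sum_erase_sq_le hcard' horth f k₀)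
      (by positivity))
    rw [Finset.sum_mul]
    refine Finset.sum_le_sum fun k hk => mul_le_mul_of_nonneg_left ?_ (sq_nonneg _)
    have hk := Finset.ne_of_mem_erase hk
    refine (Finset.sum_le_card_nsmul _ _ (2 / (1 - b1)) fun i _ => ?_).trans_eq (by simp)
    refine (one_add_two_mul_sum_pow_le (hβbot k) (hβtop k hk) i).trans ?_
    gcongr
    exact hle k hk
  have hsum := (sub_le_iff_le_add.1 h).trans (add_le_add_right hstat _)
  rw [← le_div_iff₀' (by positivity)] at hsum
  refine hsum.trans_eq ?_
  have : 1 - b ≠ 0 := by linarith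
  field_simp
  ring
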